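/- Let U ⊆ ℂ^k be an open set on which P_s has k pairwise distinct roots, and let Ψ : U → ℂ^k be a holomorphic solution of the system (@@). Then Φ(s) := P'_s(A(s))^{−1}·Ψ(s) is a solution of the system (@) on U. -/

import Mathlib

open Matrix Complex

noncomputable section

/-- The universal monic polynomial `P_s(z) = Σ_{h=0}^{k} (−1)^h s_h z^{k−h}` (with `s_0 = 1`),
where `s i` represents the `(i+1)`-st coefficient `s_{i+1}`. -/
def LP (k : ℕ) (s : Fin k → ℂ) (z : ℂ) : ℂ :=
  z ^ k + ∑ i : Fin k, (-1 : ℂ) ^ ((i : ℕ) + 1) * s i * z ^ (k - 1 - (i : ℕ))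

/-- The companion matrix `A(s)` of `P_s`. -/
def LcompA (k : ℕ) (s : Fin k → ℂ) : Matrix (Fin k) (Fin k) ℂ := fun i j =>
  if (i : ℕ) = k - 1 then
    (-1 : ℂ) ^ (k - 1 - (j : ℕ)) * s ⟨k - 1 - (j : ℕ), by have := j.isLt; omega⟩
  else if (j : ℕ) = (i : ℕ) + 1 then 1 else 0

/-- `P'_s(A(s)) = Σ_{h=0}^{k−1} (−1)^h (k−h) s_h A(s)^{k−h−1}` (with `s_0 = 1`). -/
def LPprimeA (k : ℕ) (s : Fin k → ℂ) : Matrix (Fin k) (Fin k) ℂ :=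
  (k : ℂ) • LcompA k s ^ (k - 1) + ∑ i : Fin k,
    ((-1 : ℂ) ^ ((i : ℕ) + 1) * ((k - 1 - (i : ℕ) : ℕ) : ℂ) * s i) •
      LcompA k s ^ (k - 2 - (i : ℕ))

/-- The system (@) at a point `s`: `(−1)^{k+h} ∂Φ/∂s_h = ∂(A(s)^{k−h} Φ)/∂s_k`
for every `h ∈ {1, …, k−1}`. -/
def SatA (k : ℕ) (Φ : (Fin k → ℂ) → Fin k → ℂ) (s : Fin k → ℂ) : Prop :=
  ∀ h : ℕ, ∀ _h1 : 1 ≤ h, ∀ _h2 : h ≤ k - 1,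
    ((-1 : ℂ) ^ (k + h)) •
        fderiv ℂ Φ s (Pi.single (⟨h - 1, by omega⟩ : Fin k) (1 : ℂ))
      = fderiv ℂ (fun t => (LcompA k t ^ (k - h)) *ᵥ Φ t) s
          (Pi.single (⟨k - 1, by omega⟩ : Fin k) (1 : ℂ))

/-- The system (@@) at a point `s`:
`(−1)^{k+h} ∂Ψ/∂s_h = ∂(A(s)^{k−h} Ψ)/∂s_k + (−1)^k (k−h) A(s)^{k−h−1} P'_s(A(s))⁻¹ Ψ`
for every `h ∈ {1, …, k−1}`. -/
def SatAA (k : ℕ) (Ψ : (Fin k → ℂ) → Fin k → ℂ) (s : Fin k → ℂ) : Prop :=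
  ∀ h : ℕ, ∀ _h1 : 1 ≤ h, ∀ _h2 : h ≤ k - 1,
    ((-1 : ℂ) ^ (k + h)) •
        fderiv ℂ Ψ s (Pi.single (⟨h - 1, by omega⟩ : Fin k) (1 : ℂ))
      = fderiv ℂ (fun t => (LcompA k t ^ (k - h)) *ᵥ Ψ t) s
          (Pi.single (⟨k - 1, by omega⟩ : Fin k) (1 : ℂ))
        + ((-1 : ℂ) ^ k * ((k - h : ℕ) : ℂ)) •
            ((LcompA k s ^ (k - h - 1)) *ᵥ ((LPprimeA k s)⁻¹ *ᵥ Ψ s))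

section Helpers

open scoped Matrix.Norms.Operator Topology

lemma fderiv_mulVec {E : Type*} [NormedAddCommGroup E] [NormedSpace ℂ E] {k : ℕ}
    {M : E → Matrix (Fin k) (Fin k) ℂ} {v : E → Fin k → ℂ} {s : E}
    (hM : DifferentiableAt ℂ M s) (hv : DifferentiableAt ℂ v s) :
    DifferentiableAt ℂ (fun t => M t *ᵥ v t) s ∧
      ∀ e, fderiv ℂ (fun t => M t *ᵥ v t) s e
        = fderiv ℂ M s e *ᵥ v s + M s *ᵥ fderiv ℂ v s e := by
  have h := (LinearMap.toContinuousBilinearMap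
    (Matrix.mulVecBilin (m := Fin k) (n := Fin k) (A := ℂ) ℂ ℂ)).hasFDerivAt_of_bilinear
      hM.hasFDerivAt hv.hasFDerivAt
  refine ⟨h.differentiableAt, fun e => ?_⟩
  have h' := congrArg (fun L => L e) h.fderiv
  refine h'.trans ?_
  rw [add_comm]
  rfl

/-- The linear part of the affine map `s ↦ A(s)`. -/
def compALinear (k : ℕ) : (Fin k → ℂ) →ₗ[ℂ] Matrix (Fin k) (Fin k) ℂ where
  toFun t := fun i j => if (i : ℕ) = k - 1 then
    (-1 : ℂ) ^ (k - 1 - (j : ℕ)) * t ⟨k - 1 - (j : ℕ), by have := j.isLt; omega⟩ else 0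
  map_add' x y := by
    ext i j
    change (if (i : ℕ) = k - 1 then _ else _ : ℂ)
      = (if (i : ℕ) = k - 1 then _ else _ : ℂ) + (if (i : ℕ) = k - 1 then _ else _ : ℂ)
    split_ifs
    · exact mul_add _ _ _
    · exact (add_zero _).symm
  map_smul' c x := by
    ext i j
    change (if (i : ℕ) = k - 1 then _ else _) = c * (if (i : ℕ) = k - 1 then _ else _)
    split_ifs
    · exact mul_left_comm _ _ _
    · exact (mul_zero _).symm

lemma compALinear_apply {k : ℕ} (t : Fin k → ℂ) (i j : Fin k) :
    compALinear k t i j = if (i : ℕ) = k - 1 then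
      (-1 : ℂ) ^ (k - 1 - (j : ℕ)) * t ⟨k - 1 - (j : ℕ), by have := j.isLt; omega⟩ else 0 :=
  rfl

lemma LcompA_eq (k : ℕ) (t : Fin k → ℂ) :
    LcompA k t = LcompA k 0 + compALinear k t := by
  ext i j
  simp only [LcompA, compALinear_apply, Matrix.add_apply, Pi.zero_apply]
  split_ifs <;> simp

lemma hasFDerivAt_LcompA (k : ℕ) (s : Fin k → ℂ) :
    HasFDerivAt (LcompA k) (LinearMap.toContinuousLinearMap (compALinear k)) s := by
  have h := (LinearMap.toContinuousLinearMap (compALinear k)).hasFDerivAt (x := s)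
  have h2 := h.const_add (LcompA k 0)
  exact h2.congr_of_eventuallyEq (Filter.Eventually.of_forall fun t => LcompA_eq k t)

lemma LcompA_pow_zero_row {k : ℕ} (s : Fin k → ℂ) (hk : 0 < k) (m : ℕ) (hm : m ≤ k - 1)
    (j : Fin k) :
    (LcompA k s ^ m) ⟨0, hk⟩ j = if (j : ℕ) = m then 1 else 0 := by
  induction m generalizing j with
  | zero => simp [Matrix.one_apply, Fin.ext_iff, eq_comm]
  | succ m ih =>
    rw [pow_succ, Matrix.mul_apply, Finset.sum_eq_single ⟨m, by omega⟩]
    · rw [ih (by omega)]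
      simp only [LcompA]
      rw [if_neg (by omega : ¬ m = k - 1)]
      simp
    · intro b _ hb
      rw [ih (by omega), if_neg (fun h => hb (Fin.ext h)), zero_mul]
    · simp

lemma compALinear_single {k : ℕ} (s : Fin k → ℂ) (h : ℕ) (h1 : 1 ≤ h) (h2 : h ≤ k - 1) :
    (-1 : ℂ) ^ (k + h) • compALinear k (Pi.single (⟨h - 1, by omega⟩ : Fin k) (1 : ℂ))
      = compALinear k (Pi.single (⟨k - 1, by omega⟩ : Fin k) (1 : ℂ)) * LcompA k s ^ (k - h) := by
  have hk : 0 < k := by omega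
  ext i j
  rw [Matrix.mul_apply, Finset.sum_eq_single ⟨0, hk⟩, LcompA_pow_zero_row s hk _ (by omega)]
  · simp only [compALinear_apply, Matrix.smul_apply, Pi.single_apply, Fin.ext_iff, smul_eq_mul]
    have := j.isLt
    by_cases hi : (i : ℕ) = k - 1
    · by_cases hj : (j : ℕ) = k - h
      · rw [if_pos hi, if_pos hi, if_pos hj, if_pos (by omega), if_pos (by omega), hj,
          show k - 1 - (k - h) = h - 1 by omega, mul_one, mul_one, mul_one, ← pow_add,
          show k + h + (h - 1) = (k - 1 - 0) + 2 * h by omega, pow_add, pow_mul]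
        simp
      · rw [if_pos hi, if_neg (by omega), if_neg hj]
        simp
    · simp [hi]
  · intro b _ hb
    have hb' : (b : ℕ) ≠ 0 := fun h => hb (Fin.ext h)
    have := b.isLt
    simp only [compALinear_apply, Pi.single_apply, Fin.ext_iff]
    rw [if_neg (by omega : ¬ k - 1 - (b : ℕ) = k - 1)]
    simp
  · simp

lemma differentiableAt_LcompA_pow (k : ℕ) (s : Fin k → ℂ) (p : ℕ) :
    DifferentiableAt ℂ (fun t => LcompA k t ^ p) s :=
  (hasFDerivAt_LcompA k s).differentiableAt.fun_pow p

lemma fderiv_LcompA_pow {k : ℕ} (s : Fin k → ℂ) (h : ℕ) (h1 : 1 ≤ h) (h2 : h ≤ k - 1) (p : ℕ) :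
    (-1 : ℂ) ^ (k + h) • fderiv ℂ (fun t => LcompA k t ^ p) s
        (Pi.single (⟨h - 1, by omega⟩ : Fin k) (1 : ℂ))
      = fderiv ℂ (fun t => LcompA k t ^ p) s (Pi.single (⟨k - 1, by omega⟩ : Fin k) (1 : ℂ))
        * LcompA k s ^ (k - h) := by
  induction p with
  | zero => simp
  | succ p ih =>
    have hA := hasFDerivAt_LcompA k s
    have key : ∀ e, fderiv ℂ (fun t => LcompA k t ^ (p + 1)) s e
        = LcompA k s ^ p * compALinear k e
          + fderiv ℂ (fun t => LcompA k t ^ p) s e * LcompA k s := by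
      intro e
      simp only [pow_succ]
      exact DFunLike.congr_fun
        ((differentiableAt_LcompA_pow k s p).hasFDerivAt.fun_mul' hA).fderiv e
    rw [key, key, smul_add, ← mul_smul_comm, compALinear_single s h h1 h2, ← smul_mul_assoc, ih,
      add_mul, mul_assoc, mul_assoc, mul_assoc, ← pow_succ, ← pow_succ']

lemma fderiv_sum_smul_pow {k : ℕ} {𝔸 : Type*} [NormedRing 𝔸] [NormedAlgebra ℂ 𝔸]
    {a : (Fin k → ℂ) → 𝔸} {s : Fin k → ℂ} (ha : DifferentiableAt ℂ a s) (b : ℂ) (n : ℕ)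
    (c : Fin k → ℂ) (q : Fin k → ℕ) :
    DifferentiableAt ℂ (fun t => b • a t ^ n + ∑ i, (c i * t i) • a t ^ q i) s ∧
      ∀ e, fderiv ℂ (fun t => b • a t ^ n + ∑ i, (c i * t i) • a t ^ q i) s e
        = b • fderiv ℂ (fun t => a t ^ n) s e + ∑ i,
          ((c i * s i) • fderiv ℂ (fun t => a t ^ q i) s e + (c i * e i) • a s ^ q i) := by
  have h := ((ha.fun_pow n).hasFDerivAt.fun_const_smul b).fun_add
    (HasFDerivAt.fun_sum (u := Finset.univ) fun (i : Fin k) _ =>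
      ((hasFDerivAt_apply (𝕜 := ℂ) i s).const_mul (c i)).fun_smul (ha.fun_pow (q i)).hasFDerivAt)
  refine ⟨h.differentiableAt, fun e => ?_⟩
  rw [h.fderiv]
  simp

lemma fderiv_LPprimeA {k : ℕ} (s : Fin k → ℂ) :
    DifferentiableAt ℂ (LPprimeA k) s ∧ ∀ e, fderiv ℂ (LPprimeA k) s e
      = (k : ℂ) • fderiv ℂ (fun t => LcompA k t ^ (k - 1)) s e + ∑ i : Fin k,
        (((-1 : ℂ) ^ ((i : ℕ) + 1) * ((k - 1 - (i : ℕ) : ℕ) : ℂ) * s i) •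
          fderiv ℂ (fun t => LcompA k t ^ (k - 2 - (i : ℕ))) s e
        + ((-1 : ℂ) ^ ((i : ℕ) + 1) * ((k - 1 - (i : ℕ) : ℕ) : ℂ) * e i) •
          LcompA k s ^ (k - 2 - (i : ℕ))) :=
  fderiv_sum_smul_pow (hasFDerivAt_LcompA k s).differentiableAt (k : ℂ) (k - 1)
    (fun i => (-1 : ℂ) ^ ((i : ℕ) + 1) * ((k - 1 - (i : ℕ) : ℕ) : ℂ)) (fun i => k - 2 - (i : ℕ))

lemma fderiv_LPprimeA_single {k : ℕ} (s : Fin k → ℂ) (h : ℕ) (h1 : 1 ≤ h) (h2 : h ≤ k - 1) :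
    (-1 : ℂ) ^ (k + h) • fderiv ℂ (LPprimeA k) s
        (Pi.single (⟨h - 1, by omega⟩ : Fin k) (1 : ℂ))
      = fderiv ℂ (LPprimeA k) s (Pi.single (⟨k - 1, by omega⟩ : Fin k) (1 : ℂ))
          * LcompA k s ^ (k - h)
        + ((-1 : ℂ) ^ k * ((k - h : ℕ) : ℂ)) • LcompA k s ^ (k - h - 1) := by
  have hsum : ∀ (l : Fin k), ∑ i : Fin k,
      ((-1 : ℂ) ^ ((i : ℕ) + 1) * ((k - 1 - (i : ℕ) : ℕ) : ℂ)
        * (Pi.single l (1 : ℂ) : Fin k → ℂ) i) • LcompA k s ^ (k - 2 - (i : ℕ))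
      = ((-1 : ℂ) ^ ((l : ℕ) + 1) * ((k - 1 - (l : ℕ) : ℕ) : ℂ)) •
          LcompA k s ^ (k - 2 - (l : ℕ)) := by
    intro l
    rw [Finset.sum_eq_single l]
    · simp
    · intro b _ hb
      simp [Pi.single_eq_of_ne hb]
    · simp
  rw [(fderiv_LPprimeA s).2, (fderiv_LPprimeA s).2, Finset.sum_add_distrib, Finset.sum_add_distrib,
    hsum, hsum]
  simp only [smul_add, add_mul, Finset.smul_sum, Finset.sum_mul, smul_mul_assoc,
    ← fderiv_LcompA_pow s h h1 h2]
  have e1 : (-1 : ℂ) ^ (k + h) • ((-1 : ℂ) ^ (h - 1 + 1) * ((k - 1 - (h - 1) : ℕ) : ℂ)) •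
      LcompA k s ^ (k - 2 - (h - 1))
      = ((-1 : ℂ) ^ k * ((k - h : ℕ) : ℂ)) • LcompA k s ^ (k - h - 1) := by
    rw [smul_smul, show h - 1 + 1 = h by omega, show k - 1 - (h - 1) = k - h by omega,
      show k - 2 - (h - 1) = k - h - 1 by omega, ← mul_assoc, ← pow_add,
      show k + h + h = k + 2 * h by omega, pow_add, pow_mul]
    simp
  rw [e1]
  simp only [Nat.sub_self, Nat.cast_zero, mul_zero, zero_smul, add_zero]
  rw [← add_assoc, smul_comm]
  congr 2
  exact Finset.sum_congr rfl fun i _ => smul_comm _ _ _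

/-- `P_s` as a polynomial. -/
def polyP (k : ℕ) (s : Fin k → ℂ) : Polynomial ℂ :=
  Polynomial.X ^ k + ∑ i : Fin k,
    Polynomial.C ((-1 : ℂ) ^ ((i : ℕ) + 1) * s i) * Polynomial.X ^ (k - 1 - (i : ℕ))

lemma eval_polyP (k : ℕ) (s : Fin k → ℂ) (z : ℂ) : (polyP k s).eval z = LP k s z := by
  simp [polyP, LP, Polynomial.eval_finsetSum]

lemma eval_derivative_polyP (k : ℕ) (s : Fin k → ℂ) (z : ℂ) :
    (polyP k s).derivative.eval z = k * z ^ (k - 1) + ∑ i : Fin k,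
      ((-1 : ℂ) ^ ((i : ℕ) + 1) * ((k - 1 - (i : ℕ) : ℕ) : ℂ) * s i) * z ^ (k - 2 - (i : ℕ)) := by
  simp only [polyP, Polynomial.derivative_add, Polynomial.derivative_X_pow,
    Polynomial.derivative_sum, Polynomial.derivative_C_mul, Polynomial.eval_add,
    Polynomial.eval_finsetSum, Polynomial.eval_mul, Polynomial.eval_C, Polynomial.eval_pow,
    Polynomial.eval_X]
  congr 1
  refine Finset.sum_congr rfl fun i _ => ?_
  rw [show k - 1 - (i : ℕ) - 1 = k - 2 - (i : ℕ) by omega]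
  ring

lemma eval_derivative_polyP_ne_zero {k : ℕ} {s z : Fin k → ℂ} (hz : Function.Injective z)
    (hroot : ∀ j, LP k s (z j) = 0) (j : Fin k) : (polyP k s).derivative.eval (z j) ≠ 0 := by
  have hprod : polyP k s = ∏ i, (Polynomial.X - Polynomial.C (z i)) := by
    refine Polynomial.eq_of_degree_sub_lt_of_eval_index_eq (v := z) Finset.univ hz.injOn ?_ ?_
    · have hlow : (∑ i : Fin k, Polynomial.C ((-1 : ℂ) ^ ((i : ℕ) + 1) * s i)
          * Polynomial.X ^ (k - 1 - (i : ℕ))).degree < (k : WithBot ℕ) := by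
        refine (Polynomial.degree_sum_le _ _).trans_lt ?_
        refine (Finset.sup_lt_iff (WithBot.bot_lt_coe k)).2 fun i _ => ?_
        refine (Polynomial.degree_C_mul_X_pow_le _ _).trans_lt ?_
        have := i.isLt
        exact WithBot.coe_lt_coe.2 (by omega : k - 1 - (i : ℕ) < k)
      have hdeg : (polyP k s).degree = k := by
        rw [polyP, Polynomial.degree_add_eq_left_of_degree_lt] <;>
          rw [Polynomial.degree_X_pow]
        exact hlow
      have hmonic : (polyP k s).Monic := Polynomial.monic_X_pow_add hlow
      have hmonic' : (∏ i, (Polynomial.X - Polynomial.C (z i))).Monic :=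
        Polynomial.monic_prod_of_monic _ _ fun i _ => Polynomial.monic_X_sub_C _
      have hdeg' : (∏ i, (Polynomial.X - Polynomial.C (z i))).degree = (k : WithBot ℕ) := by
        rw [Polynomial.degree_prod]
        simp
      have hlt := Polynomial.degree_sub_lt_left (hdeg.trans hdeg'.symm) hmonic.ne_zero
        (hmonic.leadingCoeff.trans hmonic'.leadingCoeff.symm)
      rwa [Finset.card_fin, ← hdeg]
    · intro i _
      rw [eval_polyP, hroot, Polynomial.eval_prod, Finset.prod_eq_zero (Finset.mem_univ i)]
      simp
  have hsep : (polyP k s).Separable := by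
    rw [hprod]
    exact Polynomial.separable_prod_X_sub_C_iff.2 hz
  exact hsep.eval₂_derivative_ne_zero (RingHom.id ℂ) ((eval_polyP k s (z j)).trans (hroot j))

lemma LcompA_mulVec {k : ℕ} {s : Fin k → ℂ} {z : ℂ} (hz : LP k s z = 0) :
    LcompA k s *ᵥ (fun i : Fin k => z ^ (i : ℕ)) = z • fun i : Fin k => z ^ (i : ℕ) := by
  ext i
  have hi := i.isLt
  simp only [Matrix.mulVec, dotProduct, Pi.smul_apply, smul_eq_mul, LcompA]
  by_cases h : (i : ℕ) = k - 1
  · simp only [h, if_true]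
    rw [← pow_succ', show k - 1 + 1 = k by omega]
    rw [LP] at hz
    rw [eq_neg_of_add_eq_zero_left hz, ← Finset.sum_neg_distrib]
    refine Fintype.sum_equiv Fin.revPerm _ _ fun j => ?_
    have hj := j.isLt
    have e : (⟨k - 1 - (j : ℕ), by omega⟩ : Fin k) = Fin.revPerm j := by
      ext
      simp [Fin.val_rev]
      omega
    have e' : ((Fin.revPerm j : Fin k) : ℕ) = k - 1 - (j : ℕ) := by rw [← e]
    rw [e, e', show k - 1 - (k - 1 - (j : ℕ)) = j by omega]
    ring
  · simp only [h, if_false]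
    rw [Finset.sum_eq_single ⟨(i : ℕ) + 1, by omega⟩]
    · simp [pow_succ']
    · intro b _ hb
      rw [if_neg fun h => hb (Fin.ext h), zero_mul]
    · simp

lemma LcompA_pow_mulVec {k : ℕ} {s : Fin k → ℂ} {z : ℂ} (hz : LP k s z = 0) (p : ℕ) :
    LcompA k s ^ p *ᵥ (fun i : Fin k => z ^ (i : ℕ)) = z ^ p • fun i : Fin k => z ^ (i : ℕ) := by
  induction p with
  | zero => simp
  | succ p ih =>
    rw [pow_succ, ← Matrix.mulVec_mulVec, LcompA_mulVec hz, Matrix.mulVec_smul, ih, smul_smul,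
      ← pow_succ']

lemma LPprimeA_mulVec {k : ℕ} {s : Fin k → ℂ} {z : ℂ} (hz : LP k s z = 0) :
    LPprimeA k s *ᵥ (fun i : Fin k => z ^ (i : ℕ))
      = (polyP k s).derivative.eval z • fun i : Fin k => z ^ (i : ℕ) := by
  rw [eval_derivative_polyP, LPprimeA, Matrix.add_mulVec, Matrix.sum_mulVec, Matrix.smul_mulVec,
    LcompA_pow_mulVec hz, add_smul, Finset.sum_smul, smul_smul]
  congr 1
  refine Finset.sum_congr rfl fun i _ => ?_
  rw [Matrix.smul_mulVec, LcompA_pow_mulVec hz, smul_smul]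

lemma isUnit_LPprimeA {k : ℕ} {s z : Fin k → ℂ} (hz : Function.Injective z)
    (hroot : ∀ j, LP k s (z j) = 0) : IsUnit (LPprimeA k s) := by
  have hmul : LPprimeA k s * (Matrix.vandermonde z)ᵀ
      = (Matrix.vandermonde z)ᵀ * Matrix.diagonal fun j => (polyP k s).derivative.eval (z j) := by
    ext i j
    rw [Matrix.mul_diagonal]
    have h := congrFun (LPprimeA_mulVec (hroot j)) i
    simpa [Matrix.mul_apply, Matrix.mulVec, dotProduct, Matrix.vandermonde_apply, mul_comm] using h
  have hdet := congrArg Matrix.det hmul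
  rw [Matrix.det_mul, Matrix.det_mul, Matrix.det_transpose, mul_comm, Matrix.det_diagonal] at hdet
  rw [Matrix.isUnit_iff_isUnit_det,
    mul_left_cancel₀ (Matrix.det_vandermonde_ne_zero_iff.2 hz) hdet, isUnit_iff_ne_zero]
  exact Finset.prod_ne_zero_iff.2 fun j _ => eval_derivative_polyP_ne_zero hz hroot j

lemma commute_LPprimeA (k : ℕ) (s : Fin k → ℂ) (p : ℕ) :
    Commute (LcompA k s ^ p) (LPprimeA k s) := by
  refine Commute.add_right ((Commute.pow_pow_self _ _ _).smul_right _) ?_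
  exact Commute.sum_right _ _ _ fun i _ => (Commute.pow_pow_self _ _ _).smul_right _

/-- If `Ψ` is differentiable on an open set where `P'_s(A(s))` is invertible and solves (@@)
at a point, then `P'_s(A(s))⁻¹ Ψ` solves (@) at that point. -/
lemma SatAA.satA_inv_mulVec {k : ℕ} {U : Set (Fin k → ℂ)} (hU : IsOpen U)
    (hunit : ∀ t ∈ U, IsUnit (LPprimeA k t)) {Ψ : (Fin k → ℂ) → Fin k → ℂ}
    (hΨdiff : DifferentiableOn ℂ Ψ U) {s : Fin k → ℂ} (hs : s ∈ U) (hsol : SatAA k Ψ s) :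
    SatA k (fun t => (LPprimeA k t)⁻¹ *ᵥ Ψ t) s := by
  intro h h1 h2
  have hnhds : U ∈ 𝓝 s := hU.mem_nhds hs
  have hQ := (fderiv_LPprimeA s).1
  have hQinv : DifferentiableAt ℂ (fun t => (LPprimeA k t)⁻¹) s := by
    simp only [Matrix.nonsing_inv_eq_ringInverse]
    exact hQ.inverse (hunit s hs)
  have hcancel : ∀ t ∈ U, ∀ v, LPprimeA k t *ᵥ ((LPprimeA k t)⁻¹ *ᵥ v) = v := fun t ht v => by
    rw [Matrix.mulVec_mulVec,
      Matrix.mul_nonsing_inv _ ((Matrix.isUnit_iff_isUnit_det _).1 (hunit t ht)),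
      Matrix.one_mulVec]
  have hΦ := (fderiv_mulVec hQinv (hΨdiff.differentiableAt hnhds)).1
  set Φ := fun t => (LPprimeA k t)⁻¹ *ᵥ Ψ t
  have hAΦ := (fderiv_mulVec (differentiableAt_LcompA_pow k s (k - h)) hΦ).1
  have eΨ : Ψ =ᶠ[𝓝 s] fun t => LPprimeA k t *ᵥ Φ t := by
    filter_upwards [hnhds] with t ht using (hcancel t ht _).symm
  have eAΨ : (fun t => LcompA k t ^ (k - h) *ᵥ Ψ t)
      =ᶠ[𝓝 s] fun t => LPprimeA k t *ᵥ (LcompA k t ^ (k - h) *ᵥ Φ t) := by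
    filter_upwards [eΨ] with t ht
    rw [ht]
    simp only [Matrix.mulVec_mulVec (Φ t), (commute_LPprimeA k t (k - h)).eq]
  have hmain := hsol h h1 h2
  rw [eΨ.fderiv_eq, eAΨ.fderiv_eq, (fderiv_mulVec hQ hΦ).2, (fderiv_mulVec hQ hAΦ).2, smul_add,
    ← Matrix.smul_mulVec, fderiv_LPprimeA_single s h h1 h2, Matrix.add_mulVec,
    ← Matrix.mulVec_mulVec, Matrix.smul_mulVec, ← Matrix.mulVec_smul] at hmain
  refine Matrix.mulVec_injective_of_isUnit (hunit s hs) ?_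
  rw [add_right_comm] at hmain
  have hcomp := add_left_cancel (add_right_cancel hmain)
  exact (Matrix.mulVec_smul _ _ _).trans hcomp

end Helpers

/-- on an open set `U` where `P_s` has `k` pairwise distinct roots, if `Ψ` is a
holomorphic solution of (@@) on `U` then `Φ(s) := P'_s(A(s))⁻¹ Ψ(s)` is a solution of (@)
on `U`. -/
theorem PprimeA_inv_maps_singular_solutions_to_solutions
    (k : ℕ) (hk : 2 ≤ k) (U : Set (Fin k → ℂ)) (hU : IsOpen U)
    (hdist : ∀ s ∈ U, ∃ z : Fin k → ℂ, Function.Injective z ∧ ∀ j : Fin k, LP k s (z j) = 0)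
    (Ψ : (Fin k → ℂ) → Fin k → ℂ) (hΨdiff : DifferentiableOn ℂ Ψ U)
    (hΨsol : ∀ s ∈ U, SatAA k Ψ s) :
    ∀ s ∈ U, SatA k (fun t => (LPprimeA k t)⁻¹ *ᵥ Ψ t) s := by
  intro s hs
  refine SatAA.satA_inv_mulVec hU (fun t ht => ?_) hΨdiff hs (hΨsol s hs)
  obtain ⟨z, hz, hroot⟩ := hdist t ht
  exact isUnit_LPprimeA hz hroot
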